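/- Every finite Moufang loop has a 2-Sylow subloop and a 3-Sylow subloop. -/

import Mathlib

open Pointwise

/-- A Moufang loop: a loop (binary operation with two-sided identity in which the equations
`a * x = b` and `y * a = b` have unique solutions) satisfying the Moufang identity. -/
class MoufangLoop (M : Type*) extends Mul M, One M where
  one_mul : ∀ a : M, 1 * a = a
  mul_one : ∀ a : M, a * 1 = a
  existsUnique_mul_left : ∀ a b : M, ∃! x : M, a * x = b
  existsUnique_mul_right : ∀ a b : M, ∃! y : M, y * a = b
  moufang : ∀ x y z : M, (x * y) * (z * x) = (x * (y * z)) * x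

namespace MoufangLoop

variable {M : Type*} [MoufangLoop M]

/-- The unique solution `x` of `a * x = b` (left division). -/
noncomputable def lsol (a b : M) : M := (existsUnique_mul_left a b).exists.choose

/-- The unique solution `y` of `y * a = b` (right division). -/
noncomputable def rsol (a b : M) : M := (existsUnique_mul_right a b).exists.choose

theorem mul_lsol (a b : M) : a * lsol a b = b := (existsUnique_mul_left a b).exists.choose_spec

theorem rsol_mul (a b : M) : rsol a b * a = b := (existsUnique_mul_right a b).exists.choose_spec

/-- A subloop: a subset closed under the loop operations (multiplication and the
two divisions; in particular it contains the identity). -/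
def IsSubloopSet (A : Set M) : Prop :=
  (1 : M) ∈ A ∧ (∀ x ∈ A, ∀ y ∈ A, x * y ∈ A) ∧
    (∀ x ∈ A, ∀ y ∈ A, lsol x y ∈ A) ∧ ∀ x ∈ A, ∀ y ∈ A, rsol x y ∈ A

/-- `B` is a normal subloop of the (sub)loop `A`:  `B ⊆ A` and, for all `x, y ∈ A`,
`B*x = x*B`, `B*(x*y) = (B*x)*y` and `(x*B)*y = x*(B*y)` (as subsets). -/
def IsNormalIn (B A : Set M) : Prop :=
  B ⊆ A ∧ (∀ x ∈ A, B * ({x} : Set M) = ({x} : Set M) * B) ∧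
    (∀ x ∈ A, ∀ y ∈ A, B * ({x * y} : Set M) = B * ({x} : Set M) * ({y} : Set M)) ∧
    ∀ x ∈ A, ∀ y ∈ A, ({x} : Set M) * B * ({y} : Set M) = ({x} : Set M) * (B * ({y} : Set M))

/-- A composition series of the subloop `A` of `M`: a strictly decreasing chain of
subloops from `A` to `{1}`, each normal in the preceding one, such that each step is
a maximal normal subloop of the preceding one (equivalently, by the correspondence
theorem, each factor is a simple loop). -/
structure CompSeriesOn (M : Type*) [MoufangLoop M] (A : Set M) where
  n : ℕ
  c : Fin (n + 1) → Set M
  subloop : ∀ i, IsSubloopSet (c i)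
  first : c 0 = A
  last : c (Fin.last n) = {1}
  normal : ∀ i : Fin n, IsNormalIn (c i.succ) (c i.castSucc)
  proper : ∀ i : Fin n, c i.succ ≠ c i.castSucc
  maximal : ∀ i : Fin n, ∀ D : Set M, IsSubloopSet D → IsNormalIn D (c i.castSucc) →
    c i.succ ⊆ D → D = c i.succ ∨ D = c i.castSucc

/-- A composition series of the loop `M` itself. -/
abbrev CompSeries (M : Type*) [MoufangLoop M] := CompSeriesOn M Set.univ

/-- `f` realizes `Q` as the quotient of the subloop `A` of `M` by its normal subloop `B`:
on `A`, `f` is multiplicative, maps onto `Q`, and its fibres are exactly the cosets of `B`.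
Thus `Q` is isomorphic to the factor loop `A/B`. -/
def IsFactorMap {Q : Type*} [Mul Q] (A B : Set M) (f : M → Q) : Prop :=
  (∀ x ∈ A, ∀ y ∈ A, f (x * y) = f x * f y) ∧ (∀ q : Q, ∃ x ∈ A, f x = q) ∧
    ∀ x ∈ A, ∀ y ∈ A, (f x = f y ↔ x ∈ ({y} : Set M) * B)

/-- A `p`-Sylow subloop: a subloop of order `p ^ k` where `p ^ k` is the largest power
of `p` dividing the order of `M`. -/
def IsPSylowSubloop (p : ℕ) (A : Set M) : Prop :=
  IsSubloopSet A ∧ Nat.card A = p ^ ((Nat.card M).factorization p)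

end MoufangLoop

namespace MoufangLoop

section Basic

variable {M : Type*} [MoufangLoop M]

theorem left_cancel {a x y : M} (h : a * x = a * y) : x = y :=
  (existsUnique_mul_left a (a * y)).unique h rfl

theorem right_cancel {a x y : M} (h : x * a = y * a) : x = y :=
  (existsUnique_mul_right a (y * a)).unique h rfl

/-- The inverse of an element of a Moufang loop. -/
noncomputable def inv (x : M) : M := lsol x 1

theorem mul_inv_self (x : M) : x * inv x = 1 := mul_lsol x 1

theorem inv_mul_mul_right (x z : M) : x * (inv x * z) = z := by
  have h := moufang x (inv x) z
  rw [mul_inv_self, one_mul] at h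
  exact (right_cancel h).symm

theorem inv_mul_self (x : M) : inv x * x = 1 := by
  have h := inv_mul_mul_right x x
  exact left_cancel (h.trans (mul_one x).symm)

theorem flexible (x z : M) : x * (z * x) = (x * z) * x := by
  have h := moufang x 1 z
  rwa [mul_one, one_mul] at h

theorem mul_inv_mul (x y : M) : (y * inv x) * x = y := by
  have h := moufang x y (inv x)
  rw [inv_mul_self, mul_one] at h
  exact left_cancel ((h.trans (flexible x (y * inv x)).symm).symm)

theorem inv_inv (x : M) : inv (inv x) = x :=
  left_cancel ((mul_inv_self (inv x)).trans (inv_mul_self x).symm)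

theorem inv_mul_cancel_left (x y : M) : inv x * (x * y) = y := by
  simpa only [inv_inv] using inv_mul_mul_right (inv x) y

theorem mul_inv_cancel_right (x y : M) : (y * x) * inv x = y := by
  simpa only [inv_inv] using mul_inv_mul (inv x) y

theorem inv_mul_rev (x y : M) : inv (x * y) = inv y * inv x := by
  have h : inv (x * y) * x = inv y := by
    have h := inv_mul_cancel_left (x * y) (inv y)
    rwa [mul_inv_cancel_right] at h
  rw [← h, mul_inv_cancel_right]

/-- The right Moufang identity. -/
theorem right_moufang (u b w : M) : ((u * b) * w) * b = u * (b * (w * b)) := by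
  have h := moufang b (inv (u * b)) ((u * b) * w)
  rw [inv_mul_cancel_left, ← flexible b w, inv_mul_rev, inv_mul_mul_right] at h
  rw [← h, inv_mul_mul_right]

/-- The left Moufang identity. -/
theorem left_moufang (a w v : M) : a * (w * (a * v)) = ((a * w) * a) * v := by
  have h := congrArg inv (right_moufang (inv v) (inv a) (inv w))
  simpa only [inv_mul_rev, inv_inv] using h

end Basic

section Colours

variable (i : ZMod 3)

theorem add_one_add_one : i + 1 + 1 = i + 2 := by revert i; decide

theorem add_one_add_two : i + 1 + 2 = i := by revert i; decide

theorem add_two_add_one : i + 2 + 1 = i := by revert i; decide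

theorem add_two_add_two : i + 2 + 2 = i + 1 := by revert i; decide

/-- Given a colour `i`, every line has colour `i`, `i + 1` or `i + 2`. -/
theorem exists_eq_add {M : Type*} (p : ZMod 3 × M) :
    ∃ x : M, p = (i, x) ∨ p = (i + 1, x) ∨ p = (i + 2, x) := by
  obtain ⟨j, x⟩ := p
  have h : j = i ∨ j = i + 1 ∨ j = i + 2 := by revert i j; decide
  rcases h with rfl | rfl | rfl <;> exact ⟨x, by simp⟩

end Colours

section Net

variable {M : Type*} [MoufangLoop M]

/-- The reflection operation on the lines of the `3`-net of a Moufang loop, the lines being indexed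
so that `(i, x)`, `(i + 1, y)`, `(i + 2, z)` are concurrent when `(x * y) * z = 1`. -/
noncomputable def refl (p q : ZMod 3 × M) : ZMod 3 × M :=
  if q.1 = p.1 then (p.1, (p.2 * inv q.2) * p.2)
  else if q.1 = p.1 + 1 then (p.1 + 2, inv (p.2 * q.2))
  else (p.1 + 1, inv (q.2 * p.2))

theorem refl_zero_zero (i : ZMod 3) (x y : M) : refl (i, x) (i, y) = (i, (x * inv y) * x) := by
  simp [refl]

theorem refl_zero_one (i : ZMod 3) (x y : M) :
    refl (i, x) (i + 1, y) = (i + 2, inv (x * y)) := by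
  have h : i + 1 ≠ i := by revert i; decide
  simp [refl, h]

theorem refl_zero_two (i : ZMod 3) (x y : M) :
    refl (i, x) (i + 2, y) = (i + 1, inv (y * x)) := by
  have h : i + 2 ≠ i := by revert i; decide
  have h' : i + 2 ≠ i + 1 := by revert i; decide
  simp only [refl, h, h', if_false]

theorem refl_one_zero (i : ZMod 3) (x y : M) :
    refl (i + 1, x) (i, y) = (i + 2, inv (y * x)) := by
  have h := refl_zero_two (i + 1) x y
  rwa [add_one_add_two, add_one_add_one] at h

theorem refl_one_two (i : ZMod 3) (x y : M) :
    refl (i + 1, x) (i + 2, y) = (i, inv (x * y)) := by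
  have h := refl_zero_one (i + 1) x y
  rwa [add_one_add_two, add_one_add_one] at h

theorem refl_two_zero (i : ZMod 3) (x y : M) :
    refl (i + 2, x) (i, y) = (i + 1, inv (x * y)) := by
  have h := refl_zero_one (i + 2) x y
  rwa [add_two_add_two, add_two_add_one] at h

theorem refl_two_one (i : ZMod 3) (x y : M) :
    refl (i + 2, x) (i + 1, y) = (i, inv (y * x)) := by
  have h := refl_zero_two (i + 2) x y
  rwa [add_two_add_two, add_two_add_one] at h

theorem refl_fst (p q : ZMod 3 × M) : (refl p q).1 = -(p.1 + q.1) := by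
  obtain ⟨i, x⟩ := p
  obtain ⟨y, rfl | rfl | rfl⟩ := exists_eq_add i q
  · rw [refl_zero_zero]; dsimp only; clear x y; revert i; decide
  · rw [refl_zero_one]; dsimp only; clear x y; revert i; decide
  · rw [refl_zero_two]; dsimp only; clear x y; revert i; decide

theorem refl_comm {p q : ZMod 3 × M} (h : p.1 ≠ q.1) : refl p q = refl q p := by
  obtain ⟨i, x⟩ := p
  obtain ⟨y, rfl | rfl | rfl⟩ := exists_eq_add i q
  · exact absurd rfl h
  · rw [refl_zero_one, refl_one_zero]
  · rw [refl_zero_two, refl_two_zero]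

theorem refl_self (p : ZMod 3 × M) : refl p p = p := by
  obtain ⟨i, x⟩ := p
  rw [refl_zero_zero, mul_inv_self, one_mul]

theorem refl_refl (p q : ZMod 3 × M) : refl p (refl p q) = q := by
  obtain ⟨i, x⟩ := p
  obtain ⟨y, rfl | rfl | rfl⟩ := exists_eq_add i q
  · rw [refl_zero_zero, refl_zero_zero, inv_mul_rev, inv_mul_rev, inv_inv, inv_mul_mul_right,
      mul_inv_mul]
  · rw [refl_zero_one, refl_zero_two, inv_mul_rev, inv_inv, inv_mul_cancel_left]
  · rw [refl_zero_two, refl_zero_one, inv_mul_rev, inv_inv, mul_inv_cancel_right]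

theorem refl_distrib_of_ne (a : ZMod 3 × M) {p q : ZMod 3 × M} (h : p.1 ≠ q.1) :
    refl a (refl p q) = refl (refl a p) (refl a q) := by
  have key : ∀ p q : ZMod 3 × M, p.1 = a.1 ∧ q.1 ≠ a.1 ∨ p.1 = a.1 + 1 ∧ q.1 = a.1 + 2 →
      refl a (refl p q) = refl (refl a p) (refl a q) := by
    intro p q h
    obtain ⟨i, a⟩ := a
    obtain ⟨x, rfl | rfl | rfl⟩ := exists_eq_add i p <;>
    obtain ⟨y, rfl | rfl | rfl⟩ := exists_eq_add i q
    · simp at h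
    · rw [refl_zero_one, refl_zero_two, refl_zero_zero, refl_zero_one, refl_zero_two]
      have e := left_moufang (inv a) x (a * y)
      rw [inv_mul_cancel_left] at e
      simp only [inv_mul_rev, inv_inv, flexible] at e ⊢
      rw [← e]
    · rw [refl_zero_two, refl_zero_one, refl_zero_zero, refl_zero_two, refl_zero_one]
      have e := right_moufang (y * a) (inv a) x
      rw [mul_inv_cancel_right] at e
      simp only [inv_mul_rev, inv_inv] at e ⊢
      rw [← e]
    · exact absurd h (by dsimp only; clear h x y a; revert i; decide)
    · exact absurd h (by dsimp only; clear h x y a; revert i; decide)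
    · rw [refl_one_two, refl_zero_zero, refl_zero_one, refl_zero_two, refl_two_one, inv_inv,
        ← inv_mul_rev, inv_inv, moufang]
    · exact absurd h (by dsimp only; clear h x y a; revert i; decide)
    · exact absurd h (by dsimp only; clear h x y a; revert i; decide)
    · exact absurd h (by dsimp only; clear h x y a; revert i; decide)
  have hc : ((p.1 = a.1 ∧ q.1 ≠ a.1 ∨ p.1 = a.1 + 1 ∧ q.1 = a.1 + 2) ∨
      (q.1 = a.1 ∧ p.1 ≠ a.1 ∨ q.1 = a.1 + 1 ∧ p.1 = a.1 + 2)) := by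
    generalize a.1 = i at *
    generalize p.1 = j at *
    generalize q.1 = k at *
    clear key
    revert i j k; decide
  rcases hc with hc | hc
  · exact key p q hc
  · rw [refl_comm h, key q p hc, refl_comm]
    rw [refl_fst, refl_fst]
    intro e
    exact h (by simpa using e.symm)

theorem refl_distrib (a p q : ZMod 3 × M) :
    refl a (refl p q) = refl (refl a p) (refl a q) := by
  by_cases h : p.1 = q.1
  · have hr : ∃ r : ZMod 3 × M, r.1 ≠ p.1 := ⟨(p.1 + 1, 1), by simp⟩
    obtain ⟨r, hr⟩ := hr
    have hq : q = refl r (refl r q) := (refl_refl r q).symm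
    have hs : (refl r q).1 ≠ r.1 ∧ p.1 ≠ (refl r q).1 := by
      rw [refl_fst, ← h]
      generalize r.1 = i at *
      generalize p.1 = j at *
      clear h hq
      revert i j; decide
    generalize refl r q = s at hq hs
    have inj : ∀ u v : ZMod 3 × M, u.1 ≠ v.1 → (refl a u).1 ≠ (refl a v).1 := by
      intro u v huv e
      rw [refl_fst, refl_fst] at e
      exact huv (by simpa using e)
    have hne : ∀ b : ZMod 3 × M, (refl b r).1 ≠ (refl b s).1 := by
      intro b e
      rw [refl_fst, refl_fst] at e
      exact hs.1 (by simpa using e.symm)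
    subst hq
    rw [refl_distrib_of_ne p hs.1.symm, refl_distrib_of_ne a (hne p), refl_distrib_of_ne a hr.symm,
      refl_distrib_of_ne a hs.2, refl_distrib_of_ne a hs.1.symm,
      refl_distrib_of_ne (refl a p) (hne a)]
  · exact refl_distrib_of_ne a h

/-- The automorphism group of the `3`-net of a Moufang loop. -/
def netAut (M : Type*) [MoufangLoop M] : Subgroup (Equiv.Perm (ZMod 3 × M)) where
  carrier := {g | (∀ p q, g (refl p q) = refl (g p) (g q)) ∧ ∀ p q, p.1 = q.1 ↔ (g p).1 = (g q).1}
  one_mem' := ⟨fun _ _ => rfl, fun _ _ => Iff.rfl⟩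
  mul_mem' := by
    rintro g h ⟨hg, hg'⟩ ⟨hh, hh'⟩
    exact ⟨fun p q => by simp [hg, hh], fun p q => by simp [← hg', ← hh']⟩
  inv_mem' := by
    rintro g ⟨hg, hg'⟩
    refine ⟨fun p q => ?_, fun p q => ?_⟩
    · rw [Equiv.Perm.inv_eq_iff_eq, hg]; simp
    · rw [hg' (g⁻¹ p) (g⁻¹ q)]; simp

/-- The reflection in a line, as an automorphism of the net. -/
noncomputable def netRefl (p : ZMod 3 × M) : netAut M :=
  ⟨⟨refl p, refl p, refl_refl p, refl_refl p⟩, refl_distrib p, fun q r => by simp [refl_fst]⟩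

end Net

end MoufangLoop

/-- A group with triality acting on the lines of a `3`-net: every point of `Ω` carries a colour and
an involution `τ p` of the group, the reflection in `p`. -/
structure TrialityAction (G Ω : Type*) [Group G] [MulAction G Ω] where
  τ : Ω → G
  col : Ω → ZMod 3
  mul_self : ∀ p, τ p * τ p = 1
  conj : ∀ (g : G) (p : Ω), τ (g • p) = g * τ p * g⁻¹
  smul_self : ∀ p, τ p • p = p
  smul_comm : ∀ p q, col p ≠ col q → τ p • q = τ q • p
  col_smul : ∀ p q, col (τ p • q) = -(col p + col q)
  col_eq_iff : ∀ (g : G) (p q : Ω), col (g • p) = col (g • q) ↔ col p = col q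
  col_surjective : Function.Surjective col

namespace TrialityAction

open MulAction Subgroup

section Counting

variable {G Ω : Type*} [Group G] [MulAction G Ω]

theorem card_orbit_mul_card_stabilizer (p : Ω) :
    Nat.card (orbit G p) * Nat.card (stabilizer G p) = Nat.card G := by
  rw [← Nat.card_prod]
  exact Nat.card_congr (orbitProdStabilizerEquivGroup G p)

theorem card_stabilizer_subgroup (Q : Subgroup G) (p : Ω) :
    Nat.card (stabilizer Q p) = Nat.card (Q ⊓ stabilizer G p : Subgroup G) := by
  refine Nat.card_congr ⟨fun x => ⟨x.1.1, x.1.2, x.2⟩, fun x => ⟨⟨x.1, x.2.1⟩, x.2.2⟩,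
    fun _ => rfl, fun _ => rfl⟩

end Counting

variable {G Ω : Type*} [Group G] [MulAction G Ω] (T : TrialityAction G Ω)

theorem inv_eq (p : Ω) : (T.τ p)⁻¹ = T.τ p := inv_eq_of_mul_eq_one_left (T.mul_self p)

theorem smul_smul (p q : Ω) : T.τ p • T.τ p • q = q := by
  rw [← mul_smul, T.mul_self, one_smul]

theorem conj_τ (p q : Ω) : T.τ (T.τ p • q) = T.τ p * T.τ q * T.τ p := by
  rw [T.conj, T.inv_eq]

theorem braid {p q : Ω} (h : T.col p ≠ T.col q) :
    T.τ p * T.τ q * T.τ p = T.τ q * T.τ p * T.τ q := by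
  rw [← T.conj_τ, ← T.conj_τ, T.smul_comm p q h]

theorem pow_three_eq_one {p q : Ω} (h : T.col p ≠ T.col q) : (T.τ p * T.τ q) ^ 3 = 1 := by
  calc (T.τ p * T.τ q) ^ 3 = (T.τ p * T.τ q * T.τ p) * (T.τ q * T.τ p * T.τ q) := by
        simp only [pow_succ, pow_zero, one_mul, mul_assoc]
    _ = (T.τ q * T.τ p * T.τ q)⁻¹ * (T.τ q * T.τ p * T.τ q) := by
        rw [T.braid h]; simp only [mul_inv_rev, T.inv_eq, mul_assoc]
    _ = 1 := inv_mul_cancel _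

theorem col_smul_ne {p q : Ω} (h : T.col p ≠ T.col q) :
    T.col (T.τ p • q) ≠ T.col p ∧ T.col (T.τ p • q) ≠ T.col q := by
  rw [T.col_smul]
  generalize T.col p = i at *
  generalize T.col q = j at *
  revert i j; decide

theorem smul_eq_of_ne {p q : Ω} (h : T.col p ≠ T.col q) : T.τ (T.τ p • q) • p = q := by
  rw [T.conj_τ, mul_smul, mul_smul, T.smul_self, ← T.smul_comm p q h, T.smul_smul]

theorem exists_col_ne (i j : ZMod 3) : ∃ p, T.col p ≠ i ∧ T.col p ≠ j := by
  have h : ∃ k : ZMod 3, k ≠ i ∧ k ≠ j := by revert i j; decide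
  obtain ⟨k, hk⟩ := h
  obtain ⟨p, rfl⟩ := T.col_surjective k
  exact ⟨p, hk⟩

theorem isPretransitive (T : TrialityAction G Ω) : IsPretransitive G Ω := by
  refine ⟨fun p q => ?_⟩
  obtain ⟨r, hp, hq⟩ := T.exists_col_ne (T.col p) (T.col q)
  refine ⟨T.τ (T.τ r • q) * T.τ (T.τ p • r), ?_⟩
  rw [mul_smul, T.smul_eq_of_ne hp.symm, T.smul_eq_of_ne hq]

theorem card_mul_card_stabilizer (T : TrialityAction G Ω) (p : Ω) :
    Nat.card Ω * Nat.card (stabilizer G p) = Nat.card G := by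
  have := T.isPretransitive
  rw [← card_orbit_mul_card_stabilizer (G := G) p, orbit_eq_univ G p, Nat.card_univ]

section Three

variable [Finite Ω]

/-- Adjoining to a `3`-group an element normalizing it whose cube it contains. -/
theorem extend_three_group {Q : Subgroup G} (hQ : IsPGroup 3 Q) {x : G}
    (hx : x ∈ normalizer (Q : Set G)) (hx3 : x ^ 3 ∈ Q) :
    IsPGroup 3 (zpowers x ⊔ Q : Subgroup G) ∧
      ∀ p : Ω, Nat.card (orbit (zpowers x ⊔ Q : Subgroup G) p) ≤ 3 * Nat.card (orbit Q p) := by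
  have hle : zpowers x ≤ normalizer (Q : Set G) := by simpa using hx
  refine ⟨IsPGroup.to_sup_of_normal_right' ?_ hQ hle, fun p => ?_⟩
  · rintro ⟨_, i, rfl⟩
    obtain ⟨k, hk⟩ := hQ ⟨_, hx3⟩
    have hk' : (x ^ 3) ^ 3 ^ k = 1 := congrArg Subtype.val hk
    refine ⟨k + 1, Subtype.ext ?_⟩
    change (x ^ i) ^ 3 ^ (k + 1) = 1
    rw [← zpow_natCast, ← zpow_mul, mul_comm, zpow_mul, zpow_natCast, pow_succ', pow_mul, hk',
      one_zpow]
  · have hsurj : ∀ y : orbit (zpowers x ⊔ Q : Subgroup G) p,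
        ∃ z : Fin 3 × orbit Q p, x ^ (z.1 : ℕ) • (z.2 : Ω) = y := by
      rintro ⟨_, ⟨g, hg⟩, rfl⟩
      have hg' : g ∈ (zpowers x : Set G) * (Q : Set G) := by
        rw [← coe_mul_of_left_le_normalizer_right _ _ hle]; exact hg
      obtain ⟨_, ⟨i, rfl⟩, q, hq, rfl⟩ := hg'
      have hmod : i % 3 = ((i % 3).toNat : ℤ) := by omega
      refine ⟨⟨⟨(i % 3).toNat, by omega⟩,
        ⟨((x ^ 3) ^ (i / 3) * q) • p, ⟨⟨_, mul_mem (zpow_mem hx3 _) hq⟩, rfl⟩⟩⟩, ?_⟩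
      change x ^ (i % 3).toNat • ((x ^ 3) ^ (i / 3) * q) • p = (x ^ i * q) • p
      rw [← mul_smul, ← mul_assoc, ← zpow_natCast x (i % 3).toNat, ← hmod, ← zpow_natCast x 3,
        ← zpow_mul, ← zpow_add]
      congr 3
      push_cast
      omega
    choose f hf using hsurj
    have := Nat.card_le_card_of_injective f (fun a b h => Subtype.ext (by rw [← hf a, h, hf b]))
    simpa using this

theorem three_group_step [Finite G] {Q : Subgroup G} (hQ : IsPGroup 3 Q) {p₀ p₁ : Ω}
    (hcol : T.col p₀ ≠ T.col p₁) (hρ : T.τ p₀ * T.τ p₁ ∈ Q)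
    (hσ : ∀ k ∈ Q, T.τ p₀ * k * (T.τ p₀)⁻¹ ∈ Q)
    (hlt : Nat.card (orbit Q p₀) < 3 ^ (Nat.card Ω).factorization 3) :
    ∃ x ∈ normalizer (Q : Set G), x ^ 3 ∈ Q ∧ x ∉ Q ∧
      T.τ p₀ * x * (T.τ p₀)⁻¹ ∈ zpowers x ⊔ Q := by
  have hσN : T.τ p₀ ∈ normalizer (Q : Set G) := mem_normalizer_fintype hσ
  by_cases hcase : ∃ q, T.τ q ∈ normalizer (Q : Set G) ∧ T.τ p₀ * T.τ q ∉ Q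
  · have hcase' : ∃ q, T.col p₀ ≠ T.col q ∧ T.τ q ∈ normalizer (Q : Set G) ∧
        T.τ p₀ * T.τ q ∉ Q := by
      obtain ⟨q, hq, hq'⟩ := hcase
      by_cases hc : T.col p₀ = T.col q
      · have hρN := le_normalizer hρ
        refine ⟨(T.τ p₀ * T.τ p₁) • q, ?_, ?_, ?_⟩
        · rw [mul_smul, T.col_smul, T.col_smul, ← hc]
          generalize T.col p₀ = i at *
          generalize T.col p₁ = j at *
          clear hρ hσ hq' hc hρN
          revert i j; decide
        · rw [T.conj]; exact mul_mem (mul_mem hρN hq) (inv_mem hρN)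
        · rw [T.conj]
          intro h
          apply hq'
          have h1 : T.τ p₀ * T.τ q = (T.τ p₀ * (T.τ p₀ * T.τ p₁)⁻¹ * (T.τ p₀)⁻¹) *
              (T.τ p₀ * ((T.τ p₀ * T.τ p₁) * T.τ q * (T.τ p₀ * T.τ p₁)⁻¹)) *
              (T.τ p₀ * T.τ p₁) := by group
          rw [h1]
          exact mul_mem (mul_mem (hσ _ (inv_mem hρ)) h) hρ
      · exact ⟨q, hc, hq, hq'⟩
    obtain ⟨q, hc, hq, hq'⟩ := hcase'
    refine ⟨T.τ p₀ * T.τ q, mul_mem hσN hq, ?_, hq', ?_⟩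
    · rw [T.pow_three_eq_one hc]; exact one_mem _
    · have h1 : T.τ p₀ * (T.τ p₀ * T.τ q) * (T.τ p₀)⁻¹ = (T.τ p₀ * T.τ q)⁻¹ := by
        rw [mul_inv_rev, T.inv_eq, T.inv_eq, ← mul_assoc, T.mul_self, one_mul]
      rw [h1]
      exact inv_mem (mem_sup_left (mem_zpowers _))
  · push Not at hcase
    have hp3 : Fact (Nat.Prime 3) := ⟨Nat.prime_three⟩
    obtain ⟨n, hn⟩ := IsPGroup.iff_card.mp hQ
    obtain ⟨m, hm⟩ := IsPGroup.card_orbit hQ p₀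
    have hdvd : 3 ^ (n + 1) ∣ Nat.card G := by
      have h1 := card_orbit_mul_card_stabilizer (G := Q) p₀
      rw [card_stabilizer_subgroup, hm, hn] at h1
      have h2 : Nat.card (Q ⊓ stabilizer G p₀ : Subgroup G) ∣ Nat.card (stabilizer G p₀) :=
        card_dvd_of_le inf_le_right
      rw [hm] at hlt
      have h3 : 3 ^ (m + 1) ∣ Nat.card Ω :=
        (pow_dvd_pow 3 ((Nat.pow_lt_pow_iff_right (by norm_num)).mp hlt)).trans
          (Nat.ordProj_dvd _ _)
      rw [← T.card_mul_card_stabilizer p₀]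
      calc 3 ^ (n + 1) = 3 ^ (m + 1) * Nat.card (Q ⊓ stabilizer G p₀ : Subgroup G) := by
            rw [pow_succ, ← h1]; ring
        _ ∣ _ := mul_dvd_mul h3 h2
    have hnormal : (Q.comap (normalizer (Q : Set G)).subtype).Normal := normal_in_normalizer
    have hquot := Sylow.prime_dvd_card_quotient_normalizer hdvd hn
    obtain ⟨y, hy⟩ := exists_prime_orderOf_dvd_card' 3 hquot
    obtain ⟨g, rfl⟩ := QuotientGroup.mk_surjective y
    have hg3 : (g : G) ^ 3 ∈ Q := by
      have := pow_orderOf_eq_one (QuotientGroup.mk g :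
        normalizer (Q : Set G) ⧸ Q.comap (normalizer (Q : Set G)).subtype)
      rw [hy, ← QuotientGroup.mk_pow, QuotientGroup.eq_one_iff] at this
      exact this
    have hgQ : (g : G) ∉ Q := by
      intro h
      have : (QuotientGroup.mk g :
          normalizer (Q : Set G) ⧸ Q.comap (normalizer (Q : Set G)).subtype) = 1 := by
        rw [QuotientGroup.eq_one_iff]; exact h
      rw [this, orderOf_one] at hy
      norm_num at hy
    refine ⟨g, g.2, hg3, hgQ, ?_⟩
    have h1 : T.τ ((g : G)⁻¹ • p₀) ∈ normalizer (Q : Set G) := by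
      rw [T.conj]; exact mul_mem (mul_mem (inv_mem g.2) hσN) (inv_mem (inv_mem g.2))
    have h2 := inv_mem (hcase _ h1)
    have h3 : T.τ p₀ * (g : G) * (T.τ p₀)⁻¹ =
        g * (T.τ p₀ * T.τ ((g : G)⁻¹ • p₀))⁻¹ := by
      rw [mul_inv_rev, T.inv_eq ((g : G)⁻¹ • p₀), T.conj]; group
    rw [h3]
    exact mul_mem (mem_sup_left (mem_zpowers _)) (mem_sup_right h2)

theorem exists_three_closed [Finite G] (h3 : 3 ∣ Nat.card Ω) {p₀ p₁ : Ω}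
    (hcol : T.col p₀ ≠ T.col p₁) :
    ∃ E : Set Ω, p₀ ∈ E ∧ p₁ ∈ E ∧ (∀ e ∈ E, ∀ f ∈ E, T.τ e • f ∈ E) ∧
      Nat.card E = 3 ^ (Nat.card Ω).factorization 3 := by
  have hp3 : Fact (Nat.Prime 3) := ⟨Nat.prime_three⟩
  have hcyc : IsPGroup 3 (zpowers (T.τ p₀ * T.τ p₁)) ∧
      Nat.card (zpowers (T.τ p₀ * T.τ p₁)) ∣ 3 := by
    have h := orderOf_dvd_of_pow_eq_one (T.pow_three_eq_one hcol)
    rw [← Nat.card_zpowers] at h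
    refine ⟨?_, h⟩
    rcases (Nat.dvd_prime Nat.prime_three).mp h with h | h
    · exact IsPGroup.of_card (n := 0) (by simpa using h)
    · exact IsPGroup.of_card (n := 1) (by simpa using h)
  have hΩ : Nat.card Ω ≠ 0 := by
    have : Nonempty Ω := ⟨p₀⟩
    exact Nat.card_pos.ne'
  let S : Set (Subgroup G) := {Q | IsPGroup 3 Q ∧ T.τ p₀ * T.τ p₁ ∈ Q ∧
    (∀ k ∈ Q, T.τ p₀ * k * (T.τ p₀)⁻¹ ∈ Q) ∧
    Nat.card (orbit Q p₀) ≤ 3 ^ (Nat.card Ω).factorization 3}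
  have hS : S.Nonempty := by
    refine ⟨zpowers (T.τ p₀ * T.τ p₁), hcyc.1, mem_zpowers _, ?_, ?_⟩
    · rintro _ ⟨i, rfl⟩
      refine ⟨-i, ?_⟩
      have h1 : T.τ p₀ * (T.τ p₀ * T.τ p₁) * (T.τ p₀)⁻¹ = (T.τ p₀ * T.τ p₁)⁻¹ := by
        rw [mul_inv_rev, T.inv_eq, T.inv_eq, ← mul_assoc, T.mul_self, one_mul]
      change (T.τ p₀ * T.τ p₁) ^ (-i) = T.τ p₀ * (T.τ p₀ * T.τ p₁) ^ i * (T.τ p₀)⁻¹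
      rw [← conj_zpow, h1, inv_zpow, zpow_neg]
    · have h1 := card_orbit_mul_card_stabilizer (G := zpowers (T.τ p₀ * T.τ p₁)) p₀
      have h2 : Nat.card (orbit (zpowers (T.τ p₀ * T.τ p₁)) p₀) ∣ 3 :=
        (Dvd.intro _ h1).trans hcyc.2
      exact Nat.le_of_dvd (by positivity) (h2.trans
        (dvd_pow_self 3 ((Nat.prime_three.factorization_pos_of_dvd hΩ h3).ne')))
  obtain ⟨Q, ⟨hQ, hρ, hσ, hle⟩, hmax⟩ := wellFounded_gt.has_min S hS
  have heq : Nat.card (orbit Q p₀) = 3 ^ (Nat.card Ω).factorization 3 := by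
    refine hle.antisymm (not_lt.mp fun hlt => ?_)
    obtain ⟨x, hx, hx3, hxQ, hσx⟩ := T.three_group_step hQ hcol hρ hσ hlt
    obtain ⟨h1, h2⟩ := extend_three_group (Ω := Ω) hQ hx hx3
    refine hmax (zpowers x ⊔ Q) ⟨h1, mem_sup_right hρ, ?_, ?_⟩ ?_
    · have : zpowers x ⊔ Q ≤ (zpowers x ⊔ Q).comap (MulAut.conj (T.τ p₀)).toMonoidHom := by
        refine sup_le ?_ fun k hk => mem_sup_right (hσ k hk)
        rw [zpowers_le]
        exact hσx
      exact fun k hk => this hk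
    · obtain ⟨m, hm⟩ := IsPGroup.card_orbit hQ p₀
      rw [hm] at hlt
      refine (h2 p₀).trans ?_
      rw [hm, ← pow_succ']
      exact Nat.pow_le_pow_right (by norm_num) ((Nat.pow_lt_pow_iff_right (by norm_num)).mp hlt)
    · exact lt_of_le_of_ne le_sup_right fun h =>
        hxQ (by rw [h]; exact mem_sup_left (mem_zpowers _))
  refine ⟨orbit Q p₀, mem_orbit_self _, ⟨⟨_, hρ⟩, ?_⟩, ?_, heq⟩
  · change (T.τ p₀ * T.τ p₁) • p₀ = p₁
    rw [mul_smul, ← T.smul_comm _ _ hcol, T.smul_smul]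
  · rintro _ ⟨⟨q, hq⟩, rfl⟩ _ ⟨⟨r, hr⟩, rfl⟩
    refine ⟨⟨q * (T.τ p₀ * (q⁻¹ * r) * (T.τ p₀)⁻¹),
      mul_mem hq (hσ _ (mul_mem (inv_mem hq) hr))⟩, ?_⟩
    change (q * (T.τ p₀ * (q⁻¹ * r) * (T.τ p₀)⁻¹)) • p₀ = T.τ (q • p₀) • r • p₀
    rw [T.conj, ← mul_smul, T.inv_eq]
    simp only [mul_smul, T.smul_self]

end Three

section Close

theorem conj_smul (p q r : Ω) : T.τ (T.τ p • q) • r = T.τ p • T.τ q • T.τ p • r := by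
  rw [T.conj_τ, mul_smul, mul_smul]

theorem braid_smul {p q : Ω} (h : T.col p ≠ T.col q) (r : Ω) :
    T.τ p • T.τ q • T.τ p • r = T.τ q • T.τ p • T.τ q • r := by
  rw [← T.conj_smul, ← T.conj_smul, T.smul_comm p q h]

theorem col_smul_of_eq {p q : Ω} (h : T.col p = T.col q) : T.col (T.τ p • q) = T.col p := by
  rw [T.col_smul, h]
  generalize T.col q = i
  revert i; decide

/-- Two points of the same colour are close when they are conjugate under the stabilizer of every
point of another colour. -/
def Close (p q : Ω) : Prop :=
  T.col p = T.col q ∧ ∀ a, T.col a ≠ T.col p → ∃ g : G, g • a = a ∧ g • p = q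

variable {T}

theorem Close.refl (p : Ω) : T.Close p p := ⟨rfl, fun a _ => ⟨1, one_smul G a, one_smul G p⟩⟩

theorem Close.symm {p q : Ω} (h : T.Close p q) : T.Close q p := by
  refine ⟨h.1.symm, fun a ha => ?_⟩
  obtain ⟨g, hg, hg'⟩ := h.2 a (h.1 ▸ ha)
  exact ⟨g⁻¹, by rw [inv_smul_eq_iff, hg], by rw [inv_smul_eq_iff, hg']⟩

theorem Close.trans {p q r : Ω} (h : T.Close p q) (h' : T.Close q r) : T.Close p r := by
  refine ⟨h.1.trans h'.1, fun a ha => ?_⟩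
  obtain ⟨g, hg, hg'⟩ := h.2 a ha
  obtain ⟨k, hk, hk'⟩ := h'.2 a (h.1 ▸ ha)
  exact ⟨k * g, by rw [mul_smul, hg, hk], by rw [mul_smul, hg', hk']⟩

theorem Close.smul {p q : Ω} (h : T.Close p q) (g : G) : T.Close (g • p) (g • q) := by
  refine ⟨(T.col_eq_iff g p q).mpr h.1, fun a ha => ?_⟩
  obtain ⟨k, hk, hk'⟩ := h.2 (g⁻¹ • a)
    (fun e => ha (by rw [← (T.col_eq_iff g (g⁻¹ • a) p), smul_inv_smul] at e; exact e))
  refine ⟨g * k * g⁻¹, ?_, ?_⟩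
  · rw [mul_smul, mul_smul, hk, smul_inv_smul]
  · rw [mul_smul, mul_smul, inv_smul_smul, hk']

variable (T)

/-- The normal subgroup of elements moving every point to a close one. -/
def closeSubgroup : Subgroup G where
  carrier := {g | ∀ p, T.Close (g • p) p}
  one_mem' p := by rw [one_smul]; exact Close.refl p
  mul_mem' := fun {g h} hg hh p => by rw [mul_smul]; exact (hg _).trans (hh p)
  inv_mem' := fun {g} hg p => by
    have h := hg (g⁻¹ • p)
    rw [smul_inv_smul] at h
    exact h.symm

instance : T.closeSubgroup.Normal where
  conj_mem n hn g p := by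
    have h := (hn (g⁻¹ • p)).smul g
    rwa [smul_inv_smul, ← mul_smul, ← mul_smul] at h

theorem close_smul_comm {b c : Ω} (h : T.col b = T.col c) :
    T.Close (T.τ c • b) (T.τ b • c) := by
  refine ⟨by rw [T.col_smul, T.col_smul, add_comm], fun a ha => ?_⟩
  rw [T.col_smul_of_eq h.symm] at ha
  have hbc : T.col a ≠ T.col (T.τ b • c) := by rwa [T.col_smul_of_eq h, h]
  have hab : T.col a ≠ T.col b := by rwa [h]
  refine ⟨(T.τ a * T.τ b * T.τ c) * (T.τ a * T.τ b * T.τ c), ?_, ?_⟩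
  · simp only [mul_smul]
    rw [← T.smul_comm a c ha, T.braid_smul hab, ← T.conj_smul b c, T.smul_comm a _ hbc,
      T.smul_smul, T.smul_self]
  · simp only [mul_smul]
    rw [T.smul_smul, T.smul_self, T.smul_comm a b hab, ← T.conj_smul b c, ← T.smul_comm a _ hbc,
      T.smul_smul]

theorem smul_smul_smul_smul {b c d : Ω} (h : T.col b = T.col c) (hd : T.col d ≠ T.col c) :
    T.τ b • T.τ c • T.τ b • T.τ c • d = T.τ (T.τ b • T.τ c • d) • d := by
  have hcb : T.col d ≠ T.col (T.τ c • b) := by rwa [T.col_smul_of_eq h.symm]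
  have hdb : T.col d ≠ T.col b := by rwa [h]
  rw [← T.conj_smul c b, ← T.smul_comm d _ hcb, T.conj_smul, ← T.smul_comm d c hd, T.conj_smul,
    ← T.smul_comm d b hdb, T.smul_smul]

theorem pow_three_mem_closeSubgroup (b c : Ω) : (T.τ b * T.τ c) ^ 3 ∈ T.closeSubgroup := by
  by_cases h : T.col b = T.col c
  · intro d
    simp only [pow_succ, pow_zero, one_mul, mul_smul]
    by_cases hd : T.col d = T.col c
    · have hcd : T.col (T.τ c • b) = T.col d := by rw [T.col_smul_of_eq h.symm, hd]
      have hbd : T.col (T.τ b • c) = T.col d := by rw [T.col_smul_of_eq h, hd, h]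
      have h1 : T.Close (T.τ c • T.τ b • T.τ c • d) (T.τ b • T.τ c • T.τ b • d) := by
        rw [← T.conj_smul c b, ← T.conj_smul b c]
        exact (T.close_smul_comm hcd.symm).trans
          (((T.close_smul_comm h).smul _).trans (T.close_smul_comm hbd))
      have h2 := ((h1.smul (T.τ b)).smul (T.τ c)).smul (T.τ b)
      simpa only [T.smul_smul] using h2
    · have hcol : ∀ e, T.col (T.τ b • T.τ c • e) = T.col e := by
        intro e
        rw [T.col_smul, T.col_smul, h]
        ring
      have h1 := T.smul_smul_smul_smul h hd
      have h2 := T.smul_smul_smul_smul (d := T.τ b • T.τ c • d) h (by rwa [hcol])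
      rw [h2, h1]
      refine (T.close_smul_comm ?_).trans ?_
      · rw [hcol, ← h1, hcol, hcol]
      · rw [T.smul_smul]
        exact Close.refl d
  · rw [T.pow_three_eq_one h]
    exact one_mem _

end Close

section Two

theorem card_orbit_eq_of_conj {P Q : Subgroup G} {g : G} (h : ∀ k ∈ P, g * k * g⁻¹ ∈ Q)
    (h' : ∀ k ∈ Q, g⁻¹ * k * g ∈ P) (p : Ω) :
    Nat.card (orbit Q (g • p)) = Nat.card (orbit P p) := by
  refine (Nat.card_congr ((MulAction.toPerm g).subtypeEquiv fun a => ⟨?_, ?_⟩)).symm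
  · rintro ⟨⟨k, hk⟩, rfl⟩
    refine ⟨⟨_, h k hk⟩, ?_⟩
    change (g * k * g⁻¹) • g • p = g • k • p
    rw [mul_smul, mul_smul, inv_smul_smul]
  · rintro ⟨⟨k, hk⟩, e⟩
    refine ⟨⟨_, h' k hk⟩, ?_⟩
    change k • g • p = g • a at e
    change (g⁻¹ * k * g) • p = a
    rw [mul_smul, mul_smul, e, inv_smul_smul]

theorem mem_of_pow_three_mem {H : Subgroup G} {x : G} (h : x ^ 3 ∈ H) {k : ℕ}
    (hk : x ^ 2 ^ k = 1) : x ∈ H := by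
  have hcop : IsCoprime (3 : ℤ) (2 ^ k : ℕ) := by
    have := Nat.isCoprime_iff_coprime.mpr (Nat.Coprime.pow_right k (by norm_num : Nat.Coprime 3 2))
    exact_mod_cast this
  obtain ⟨a, b, hab⟩ := hcop
  have hx : x = (x ^ 3) ^ a * (x ^ 2 ^ k) ^ b := by
    rw [← zpow_natCast x 3, ← zpow_natCast x (2 ^ k), ← zpow_mul, ← zpow_mul, ← zpow_add,
      mul_comm _ a, mul_comm _ b]
    rw [show a * ((3 : ℕ) : ℤ) + b * ((2 ^ k : ℕ) : ℤ) = 1 from hab, zpow_one]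
  rw [hx, hk, one_zpow, mul_one]
  exact zpow_mem h a

variable [Finite G] [Finite Ω]

/-- Every Sylow `2`-subgroup contains a reflection whose point has an orbit of full `2`-power
size. -/
theorem exists_sylow_orbit (T : TrialityAction G Ω) (Q : Sylow 2 G) (p : Ω) : ∃ s, T.τ s ∈ Q ∧
    Nat.card (orbit Q s) = 2 ^ (Nat.card Ω).factorization 2 := by
  have hp2 : Fact (Nat.Prime 2) := ⟨Nat.prime_two⟩
  have hΩ : Nat.card Ω ≠ 0 := by
    have : Nonempty Ω := ⟨p⟩
    exact Nat.card_pos.ne'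
  have hσ2 : IsPGroup 2 (zpowers (⟨T.τ p, T.smul_self p⟩ : stabilizer G p)) := by
    have h1 : (⟨T.τ p, T.smul_self p⟩ : stabilizer G p) ^ 2 = 1 :=
      Subtype.ext ((sq _).trans (T.mul_self p))
    have h := orderOf_dvd_of_pow_eq_one h1
    rw [← Nat.card_zpowers] at h
    rcases (Nat.dvd_prime Nat.prime_two).mp h with h | h
    · exact IsPGroup.of_card (n := 0) (by simpa using h)
    · exact IsPGroup.of_card (n := 1) (by simpa using h)
  obtain ⟨U, hU⟩ := hσ2.exists_le_sylow
  obtain ⟨R, hR⟩ := (U.isPGroup'.map (stabilizer G p).subtype).exists_le_sylow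
  have hσR : T.τ p ∈ R := hR ⟨_, hU (mem_zpowers _), rfl⟩
  have hcard : Nat.card (orbit R p) = 2 ^ (Nat.card Ω).factorization 2 := by
    have h1 := card_orbit_mul_card_stabilizer (G := R) p
    have hinf : IsPGroup 2 ((R : Subgroup G) ⊓ stabilizer G p : Subgroup G) :=
      R.isPGroup'.to_le inf_le_left
    obtain ⟨m, hm⟩ := IsPGroup.iff_card.mp hinf
    have h2 : 2 ^ m ∣ Nat.card (stabilizer G p) := hm ▸ card_dvd_of_le inf_le_right
    have h3 : Nat.card U ∣ 2 ^ m := by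
      rw [← hm]
      have h : Nat.card ((U : Subgroup (stabilizer G p)).map (stabilizer G p).subtype) =
          Nat.card U := Subgroup.card_map_of_injective (subtype_injective _)
      rw [← h]
      refine card_dvd_of_le (le_inf hR ?_)
      rintro _ ⟨u, -, rfl⟩
      exact u.2
    rw [U.card_eq_multiplicity, Nat.pow_dvd_pow_iff_le_right (by norm_num)] at h3
    have h4 := (Nat.prime_two.pow_dvd_iff_le_factorization Nat.card_pos.ne').mp h2
    have h5 := le_antisymm h4 h3
    have h6 : Nat.card R = _ := R.card_eq_multiplicity
    have h7 : Nat.card (stabilizer R p) = 2 ^ m := by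
      rw [← hm]; exact card_stabilizer_subgroup (R : Subgroup G) p
    rw [h7, h6, ← T.card_mul_card_stabilizer p,
      Nat.factorization_mul hΩ Nat.card_pos.ne', Finsupp.add_apply, ← h5, pow_add] at h1
    exact Nat.eq_of_mul_eq_mul_right (by positivity) h1
  obtain ⟨g, hg⟩ := MulAction.exists_smul_eq G R Q
  have hmem : ∀ k, g * k * g⁻¹ ∈ Q ↔ k ∈ R := by
    intro k
    rw [← hg]
    change g * k * g⁻¹ ∈ (g • R : Sylow 2 G).toSubgroup ↔ _
    rw [Sylow.coe_subgroup_smul, Subgroup.mem_pointwise_smul_iff_inv_smul_mem]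
    simp only [← map_inv, MulAut.smul_def, MulAut.conj_apply, inv_inv, mul_assoc,
      inv_mul_cancel_left, inv_mul_cancel, mul_one]
    exact Iff.rfl
  refine ⟨g • p, ?_, ?_⟩
  · rw [T.conj, hmem]; exact hσR
  · rw [← hcard]
    refine card_orbit_eq_of_conj (P := R) (Q := Q) (fun k hk => (hmem k).mpr hk) (fun k hk => ?_) p
    refine (hmem _).mp ?_
    rw [show g * (g⁻¹ * k * g) * g⁻¹ = k by group]
    exact hk

end Two

section TwoClosed

theorem col_smul_of_mem_closeSubgroup {g : G} (hg : g ∈ T.closeSubgroup) (p : Ω) :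
    T.col (g • p) = T.col p :=
  (hg p).1

theorem mem_orbit_of_mul_mem {P : Subgroup G} (hP : P ≤ T.closeSubgroup) {s b q : Ω}
    (hs : T.τ s ∈ normalizer (P : Set G)) (hb : T.τ b ∈ normalizer (P : Set G))
    (hbs : T.col b ≠ T.col s) (hq : T.τ s * T.τ q ∈ P) : q ∈ orbit P s := by
  have hqs : T.col q = T.col s := by
    have h := T.col_smul_of_mem_closeSubgroup (hP hq) s
    rw [mul_smul, T.col_smul, T.col_smul] at h
    rw [← h]
    ring
  set p := T.τ b • s with hp
  have hps : T.col p ≠ T.col s := (T.col_smul_ne hbs).2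
  have hpN : T.τ p ∈ normalizer (P : Set G) := by
    rw [hp, T.conj_τ]; exact mul_mem (mul_mem hb hs) hb
  have hpb : T.τ p • s = b := by
    rw [hp, ← T.smul_comm s b hbs.symm, T.smul_eq_of_ne hbs.symm]
  have hmem : T.τ (T.τ p • q) * T.τ b ∈ P := by
    have h1 : T.τ b * T.τ p * T.τ s = T.τ p := by
      have h := T.conj_τ p s
      rw [hpb] at h
      rw [h, mul_assoc _ _ (T.τ p), T.mul_self, mul_one, mul_assoc, T.mul_self, mul_one]
    have h2 : T.τ (T.τ p • q) * T.τ b =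
        T.τ b * (T.τ p * (T.τ s * T.τ q) * (T.τ p)⁻¹) * (T.τ b)⁻¹ := by
      calc T.τ (T.τ p • q) * T.τ b = (T.τ b * T.τ p * T.τ s) * T.τ q * T.τ p * T.τ b := by
            rw [h1, T.conj_τ]
        _ = _ := by rw [T.inv_eq, T.inv_eq]; simp only [mul_assoc]
    rw [h2]
    exact (mem_normalizer_iff.mp hb _).mp ((mem_normalizer_iff.mp hpN _).mp hq)
  refine ⟨⟨_, hmem⟩, ?_⟩
  change (T.τ (T.τ p • q) * T.τ b) • s = q
  have hne : T.col p ≠ T.col (T.τ p • q) := ((T.col_smul_ne (by rwa [hqs])).1).symm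
  rw [mul_smul, ← hp, ← T.smul_comm _ _ hne, T.smul_smul]

variable [Finite G] [Finite Ω]

/-- There is a `2`-subgroup of colour-preserving elements, normalized by reflections in points close
to every given point, all having orbits of full `2`-power size. -/
theorem exists_two_subgroup [Nonempty Ω] : ∃ P : Subgroup G, P ≤ T.closeSubgroup ∧
    ∀ p, ∃ a, T.Close p a ∧ T.τ a ∈ normalizer (P : Set G) ∧
      Nat.card (orbit P a) = 2 ^ (Nat.card Ω).factorization 2 := by
  have hp2 : Fact (Nat.Prime 2) := ⟨Nat.prime_two⟩
  obtain ⟨p₀⟩ := ‹Nonempty Ω›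
  obtain ⟨R⟩ : Nonempty (Sylow 2 T.closeSubgroup) := inferInstance
  obtain ⟨Q, hQ⟩ := Sylow.exists_comap_subtype_eq R
  obtain ⟨s, hsQ, hs⟩ := T.exists_sylow_orbit Q p₀
  set P : Subgroup G := (R : Subgroup T.closeSubgroup).map T.closeSubgroup.subtype with hP
  have hmemP : ∀ g, g ∈ P ↔ g ∈ Q ∧ g ∈ T.closeSubgroup := by
    intro g
    rw [hP, ← hQ]
    constructor
    · rintro ⟨x, hx, rfl⟩
      exact ⟨hx, x.2⟩
    · rintro ⟨h1, h2⟩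
      exact ⟨⟨g, h2⟩, h1, rfl⟩
  have hPF : P ≤ T.closeSubgroup := fun g hg => ((hmemP g).mp hg).2
  have hfrattini : ∀ q, ∃ n ∈ normalizer (P : Set G), T.Close q (n • s) := by
    intro q
    have := T.isPretransitive
    obtain ⟨g, rfl⟩ := MulAction.exists_smul_eq G s q
    have hg : g ∈ ((normalizer (P : Set G) ⊔ T.closeSubgroup : Subgroup G) : Set G) := by
      rw [hP, Sylow.normalizer_sup_eq_top R]; trivial
    rw [mul_normal] at hg
    obtain ⟨n, hn, f, hf, rfl⟩ := hg
    refine ⟨n, hn, ?_⟩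
    change T.Close ((n * f) • s) (n • s)
    rw [mul_smul]
    exact (hf s).smul n
  have hsN : T.τ s ∈ normalizer (P : Set G) := by
    refine mem_normalizer_fintype fun k hk => ?_
    obtain ⟨h1, h2⟩ := (hmemP k).mp hk
    exact (hmemP _).mpr ⟨mul_mem (mul_mem hsQ h1) (inv_mem hsQ),
      Normal.conj_mem inferInstance k h2 _⟩
  have hconj : ∀ n ∈ normalizer (P : Set G), T.τ (n • s) ∈ normalizer (P : Set G) := by
    intro n hn
    rw [T.conj]
    exact mul_mem (mul_mem hn hsN) (inv_mem hn)
  have horbit : orbit P s = orbit Q s := by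
    apply Set.Subset.antisymm
    · rintro _ ⟨⟨k, hk⟩, rfl⟩
      exact ⟨⟨k, ((hmemP k).mp hk).1⟩, rfl⟩
    · rintro _ ⟨⟨t, ht⟩, rfl⟩
      obtain ⟨q, hq, -⟩ := T.exists_col_ne (T.col s) (T.col s)
      obtain ⟨n, hn, hqn⟩ := hfrattini q
      refine T.mem_orbit_of_mul_mem hPF hsN (hconj n hn) (by rwa [← hqn.1]) ?_
      change T.τ s * T.τ (t • s) ∈ P
      have hxQ : T.τ s * T.τ (t • s) ∈ Q := by
        rw [T.conj]
        exact mul_mem hsQ (mul_mem (mul_mem ht hsQ) (inv_mem ht))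
      obtain ⟨k, hk⟩ := Q.isPGroup' ⟨_, hxQ⟩
      exact mem_of_pow_three_mem ((hmemP _).mpr ⟨pow_mem hxQ 3, T.pow_three_mem_closeSubgroup _ _⟩)
        (congrArg Subtype.val hk)
  refine ⟨P, hPF, fun p => ?_⟩
  obtain ⟨n, hn, hpn⟩ := hfrattini p
  refine ⟨n • s, hpn, hconj n hn, ?_⟩
  rw [← hs, ← horbit]
  refine card_orbit_eq_of_conj (fun k hk => (mem_normalizer_iff.mp hn k).mp hk) (fun k hk => ?_) s
  exact (mem_normalizer_iff''.mp hn k).mp hk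

theorem exists_two_closed {p₀ p₁ : Ω} (hcol : T.col p₀ ≠ T.col p₁) :
    ∃ E : Set Ω, p₀ ∈ E ∧ p₁ ∈ E ∧ (∀ e ∈ E, ∀ f ∈ E, T.τ e • f ∈ E) ∧
      Nat.card {e // e ∈ E ∧ T.col e = T.col p₀} = 2 ^ (Nat.card Ω).factorization 2 := by
  have : Nonempty Ω := ⟨p₀⟩
  obtain ⟨P, hPF, hP⟩ := T.exists_two_subgroup
  obtain ⟨a, ha, haN, hcard⟩ := hP p₀
  obtain ⟨b, hb, hbN, -⟩ := hP p₁
  obtain ⟨g₂, hg₂, hg₂'⟩ := hb.2 p₀ hcol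
  obtain ⟨g₁, hg₁, hg₁'⟩ := ha.2 b (by rw [← hb.1]; exact hcol.symm)
  have hga : (g₁ * g₂) • p₀ = a := by rw [mul_smul, hg₂, hg₁']
  have hgb : (g₁ * g₂) • p₁ = b := by rw [mul_smul, hg₂', hg₁]
  generalize g₁ * g₂ = g at hga hgb
  have hab : T.col a ≠ T.col b := by rwa [← ha.1, ← hb.1]
  have hcN : T.τ (T.τ a • b) ∈ normalizer (P : Set G) := by
    rw [T.conj_τ]; exact mul_mem (mul_mem haN hbN) haN
  let Z : Set Ω := {z | z = a ∨ z = b ∨ z = T.τ a • b}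
  have hZN : ∀ z ∈ Z, T.τ z ∈ normalizer (P : Set G) := by
    rintro z (rfl | rfl | rfl) <;> assumption
  have hZ : ∀ z ∈ Z, ∀ w ∈ Z, T.τ z • w ∈ Z := by
    have hba : T.τ b • a = T.τ a • b := (T.smul_comm a b hab).symm
    have hca : T.τ (T.τ a • b) • a = b := T.smul_eq_of_ne hab
    have hcb : T.τ (T.τ a • b) • b = a := by rw [← hba]; exact T.smul_eq_of_ne hab.symm
    have hbc : T.τ b • T.τ a • b = a := by rw [← hba, T.smul_smul]
    rintro z (rfl | rfl | rfl) w (rfl | rfl | rfl) <;>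
      simp only [Z, Set.mem_ofPred_eq, T.smul_self, T.smul_smul, hba, hca, hcb, hbc, true_or,
        or_true]
  refine ⟨{e | ∃ k ∈ P, ∃ z ∈ Z, g • e = k • z}, ⟨1, one_mem _, a, Or.inl rfl, ?_⟩,
    ⟨1, one_mem _, b, Or.inr (Or.inl rfl), ?_⟩, ?_, ?_⟩
  · rw [one_smul, hga]
  · rw [one_smul, hgb]
  · rintro e ⟨k, hk, z, hz, he⟩ f ⟨l, hl, w, hw, hf⟩
    refine ⟨k * (T.τ z * (k⁻¹ * l) * (T.τ z)⁻¹), mul_mem hk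
      ((mem_normalizer_iff.mp (hZN z hz) _).mp (mul_mem (inv_mem hk) hl)), _, hZ z hz w hw, ?_⟩
    have h1 : g • T.τ e • f = T.τ (g • e) • g • f := by
      rw [T.conj, ← mul_smul, ← mul_smul]; simp
    rw [h1, he, hf, T.conj, ← mul_smul, ← mul_smul]
    congr 1
    group
  · rw [← hcard]
    refine Nat.card_congr ((MulAction.toPerm g).subtypeEquiv fun e => ?_)
    change _ ↔ g • e ∈ orbit P a
    rw [← T.col_eq_iff g, hga]
    constructor
    · rintro ⟨⟨k, hk, z, hz, he⟩, hc⟩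
      rw [he, T.col_smul_of_mem_closeSubgroup (hPF hk)] at hc
      rcases hz with rfl | rfl | rfl
      · exact ⟨⟨k, hk⟩, he.symm⟩
      · exact absurd hc.symm hab
      · exact absurd hc (T.col_smul_ne hab).1
    · rintro ⟨⟨k, hk⟩, he⟩
      change k • a = g • e at he
      refine ⟨⟨k, hk, a, Or.inl rfl, he.symm⟩, ?_⟩
      rw [← he, T.col_smul_of_mem_closeSubgroup (hPF hk)]

end TwoClosed

end TrialityAction

namespace MoufangLoop

section Subloop

variable {M : Type*} [MoufangLoop M]

/-- The net of a Moufang loop carries a group with triality. -/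
noncomputable def trialityAction (M : Type*) [MoufangLoop M] :
    TrialityAction (netAut M) (ZMod 3 × M) where
  τ := netRefl
  col := Prod.fst
  mul_self p := Subtype.ext (Equiv.ext fun q => refl_refl p q)
  conj g p := by
    rw [eq_mul_inv_iff_mul_eq]
    exact Subtype.ext (Equiv.ext fun q => (g.2.1 p q).symm)
  smul_self := refl_self
  smul_comm _ _ := refl_comm
  col_smul := refl_fst
  col_eq_iff g p q := (g.2.2 p q).symm
  col_surjective i := ⟨(i, 1), rfl⟩

theorem lsol_eq (x y : M) : lsol x y = inv x * y := by
  rw [← inv_mul_cancel_left x (lsol x y), mul_lsol]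

theorem rsol_eq (x y : M) : rsol x y = y * inv x := by
  rw [← mul_inv_cancel_right x (rsol x y), rsol_mul]

variable {E : Set (ZMod 3 × M)}

/-- The lines of the first colour in a set of lines closed under reflections form a subloop, all
colours being equally represented. -/
theorem subloop_of_closed (h0 : (0, 1) ∈ E) (h1 : (1, 1) ∈ E)
    (hE : ∀ e ∈ E, ∀ f ∈ E, refl e f ∈ E) :
    IsSubloopSet {x : M | ((0, x) : ZMod 3 × M) ∈ E} ∧
      ∀ i, ∃ f : M ≃ M, ∀ x, ((0, x) : ZMod 3 × M) ∈ E ↔ ((i, f x) : ZMod 3 × M) ∈ E := by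
  have e01 : ∀ x y : M, refl (0, x) (1, y) = (2, inv (x * y)) := by
    intro x y
    have h := refl_zero_one 0 x y
    rwa [zero_add, zero_add] at h
  have e10 : ∀ x y : M, refl (1, x) (0, y) = (2, inv (y * x)) := by
    intro x y
    have h := refl_one_zero 0 x y
    rwa [zero_add, zero_add] at h
  have e02 : ∀ x y : M, refl (0, x) (2, y) = (1, inv (y * x)) := by
    intro x y
    have h := refl_zero_two 0 x y
    rwa [zero_add, zero_add] at h
  have e12 : ∀ x y : M, refl (1, x) (2, y) = (0, inv (x * y)) := by
    intro x y
    have h := refl_one_two 0 x y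
    rwa [zero_add, zero_add] at h
  have hinv : ∀ x : M, ((0, x) : ZMod 3 × M) ∈ E → ((0, inv x) : ZMod 3 × M) ∈ E := by
    intro x hx
    have h := hE _ h0 _ hx
    rwa [refl_zero_zero, mul_one, one_mul] at h
  have h02 : ∀ x : M, ((0, x) : ZMod 3 × M) ∈ E ↔ ((2, inv x) : ZMod 3 × M) ∈ E := by
    intro x
    constructor
    · intro h
      have h := hE _ h1 _ h
      rwa [e10, mul_one] at h
    · intro h
      have h := hE _ h1 _ h
      rwa [e12, one_mul, inv_inv] at h
  have h21 : ∀ x : M, ((2, inv x) : ZMod 3 × M) ∈ E ↔ ((1, x) : ZMod 3 × M) ∈ E := by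
    intro x
    constructor
    · intro h
      have h := hE _ h0 _ h
      rwa [e02, mul_one, inv_inv] at h
    · intro h
      have h := hE _ h0 _ h
      rwa [e01, one_mul] at h
  have h01 := fun x => (h02 x).trans (h21 x)
  have hmul : ∀ x y : M, ((0, x) : ZMod 3 × M) ∈ E → ((0, y) : ZMod 3 × M) ∈ E →
      ((0, x * y) : ZMod 3 × M) ∈ E := by
    intro x y hx hy
    have h := hE _ hx _ ((h01 y).mp hy)
    rwa [e01, ← h02] at h
  refine ⟨⟨h0, fun x hx y hy => hmul x y hx hy, fun x hx y hy => ?_, fun x hx y hy => ?_⟩,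
    fun i => ?_⟩
  · rw [lsol_eq]; exact hmul _ _ (hinv x hx) hy
  · rw [rsol_eq]; exact hmul _ _ hy (hinv x hx)
  · have hi : i = 0 ∨ i = 1 ∨ i = 2 := by revert i; decide
    rcases hi with rfl | rfl | rfl
    · exact ⟨Equiv.refl M, fun x => Iff.rfl⟩
    · exact ⟨Equiv.refl M, h01⟩
    · exact ⟨⟨inv, inv, inv_inv, inv_inv⟩, h02⟩

theorem exists_two_sylow [Finite M] : ∃ A : Set M, IsPSylowSubloop 2 A := by
  obtain ⟨E, h0, h1, hE, hcard⟩ := (trialityAction M).exists_two_closed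
    (p₀ := (0, 1)) (p₁ := (1, 1)) (zero_ne_one (α := ZMod 3))
  obtain ⟨hA, -⟩ := subloop_of_closed h0 h1 hE
  refine ⟨_, hA, ?_⟩
  have hM : Nat.card M ≠ 0 := by
    have : Nonempty M := ⟨1⟩
    exact Nat.card_pos.ne'
  have h3 : (3 : ℕ).factorization 2 = 0 := Nat.factorization_eq_zero_of_not_dvd (by norm_num)
  rw [Nat.card_prod, Nat.card_zmod, Nat.factorization_mul (by norm_num) hM, Finsupp.add_apply, h3,
    zero_add] at hcard
  rw [← hcard]
  exact Nat.card_congr ⟨fun x => ⟨(0, x.1), x.2, rfl⟩,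
    fun e => ⟨e.1.2, by obtain ⟨⟨i, x⟩, hx, hi⟩ := e; change i = 0 at hi; subst hi; exact hx⟩,
    fun _ => rfl, fun e => by obtain ⟨⟨i, x⟩, hx, hi⟩ := e; change i = 0 at hi; subst hi; rfl⟩

theorem exists_three_sylow [Finite M] : ∃ A : Set M, IsPSylowSubloop 3 A := by
  have hM : Nat.card M ≠ 0 := by
    have : Nonempty M := ⟨1⟩
    exact Nat.card_pos.ne'
  have hΩ : Nat.card (ZMod 3 × M) = 3 * Nat.card M := by rw [Nat.card_prod, Nat.card_zmod]
  obtain ⟨E, h0, h1, hE, hcard⟩ := (trialityAction M).exists_three_closed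
    (hΩ ▸ dvd_mul_right 3 _) (p₀ := (0, 1)) (p₁ := (1, 1)) (zero_ne_one (α := ZMod 3))
  obtain ⟨hA, hf⟩ := subloop_of_closed h0 h1 hE
  refine ⟨_, hA, ?_⟩
  choose f hf using hf
  have hcardE : Nat.card E = 3 * Nat.card {x : M | ((0, x) : ZMod 3 × M) ∈ E} := by
    have h : Nat.card (ZMod 3 × {x : M | ((0, x) : ZMod 3 × M) ∈ E}) =
        3 * Nat.card {x : M | ((0, x) : ZMod 3 × M) ∈ E} := by
      rw [Nat.card_prod, Nat.card_zmod]
    rw [← h]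
    refine (Nat.card_congr ⟨fun z => ⟨(z.1, f z.1 z.2.1), (hf _ _).mp z.2.2⟩,
      fun e => ⟨e.1.1, ⟨(f e.1.1).symm e.1.2, (hf e.1.1 _).mpr
        (by rw [Equiv.apply_symm_apply]; exact e.2)⟩⟩, fun z => ?_, fun e => ?_⟩).symm
    · simp
    · simp
  have h3 : (3 : ℕ).factorization 3 = 1 := Nat.prime_three.factorization_self
  rw [hΩ, Nat.factorization_mul (by norm_num) hM, Finsupp.add_apply, h3, pow_add, pow_one,
    hcardE] at hcard
  exact Nat.eq_of_mul_eq_mul_left (by norm_num) hcard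

end Subloop

end MoufangLoop

/-- Every finite Moufang loop has a `2`-Sylow and a `3`-Sylow subloop. -/
theorem two_three_sylow_subloop (M : Type) [MoufangLoop M] [Finite M] :
    (∃ A : Set M, MoufangLoop.IsPSylowSubloop 2 A) ∧
      ∃ B : Set M, MoufangLoop.IsPSylowSubloop 3 B := by
  exact ⟨MoufangLoop.exists_two_sylow, MoufangLoop.exists_three_sylow⟩
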